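/- Let n ∈ ℕ, let r₁,…,rₙ > 0, let [a,b] be a non-degenerate compact interval, and let w : [a,b] → [0,∞) be an upper semicontinuous weight that is nonzero on a set of weighted cardinality exceeding n (points of (a,b) counted with weight 1, the endpoints a and b with weight 1/2). Assume in addition that w is log-concave, i.e., log w : [a,b] → ℝ ∪ {−∞} is concave. Then a node system x with a ≤ x₁ ≤ ⋯ ≤ xₙ ≤ b is the unique minimizer of ‖T_x‖_w if and only if there exist n+1 points a ≤ t₀ < t₁ < ⋯ < tₙ ≤ b such that w(t_k)·T_x(t_k) = ‖T_x‖_w for k = 0,1,…,n (no interlacing with the nodes is required in the characterization). -/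

import Mathlib

open Set Filter

noncomputable section

/-- The monic generalized algebraic polynomial `T_x(t) = ∏ⱼ |t − xⱼ|^{rⱼ}`. -/
def gap {n : ℕ} (r x : Fin n → ℝ) (t : ℝ) : ℝ := ∏ j, |t - x j| ^ r j

/-- The `w`-weighted sup norm of `T_x` over `[a,b]`. -/
def wnorm (w : ℝ → ℝ) (a b : ℝ) {n : ℕ} (r x : Fin n → ℝ) : ℝ :=
  sSup ((fun t => w t * gap r x t) '' Icc a b)

/-- Admissible node systems in `[a,b]`. -/
def adm (a b : ℝ) {n : ℕ} (x : Fin n → ℝ) : Prop :=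
  Monotone x ∧ ∀ j, x j ∈ Icc a b

/-- The weight `w` is nonzero on a set of weighted cardinality exceeding `n`
(interior points of `[a,b]` count `1`, the endpoints `1/2`). -/
def weightCardGT (w : ℝ → ℝ) (a b : ℝ) (n : ℕ) : Prop :=
  ∃ T : Finset ℝ, (T : Set ℝ) ⊆ Icc a b ∧ (∀ t ∈ T, w t ≠ 0) ∧
    (n : ℝ) < ∑ t ∈ T, (if t = a ∨ t = b then (1/2 : ℝ) else 1)

lemma gap_nonneg {n : ℕ} (r x : Fin n → ℝ) (t : ℝ) : 0 ≤ gap r x t :=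
  Finset.prod_nonneg fun _ _ => Real.rpow_nonneg (abs_nonneg _) _

lemma gap_pos {n : ℕ} (r : Fin n → ℝ) {x : Fin n → ℝ} {t : ℝ} (h : ∀ j, t ≠ x j) :
    0 < gap r x t :=
  Finset.prod_pos fun j _ => Real.rpow_pos_of_pos (abs_pos.2 (sub_ne_zero.2 (h j))) _

lemma gap_eq_zero {n : ℕ} {r : Fin n → ℝ} (hr : ∀ j, 0 < r j) {x : Fin n → ℝ} {t : ℝ} {j : Fin n}
    (h : t = x j) : gap r x t = 0 :=
  Finset.prod_eq_zero (Finset.mem_univ j) (by simp [h, (hr j).ne'])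

lemma ne_node_of_gap_pos {n : ℕ} {r : Fin n → ℝ} (hr : ∀ j, 0 < r j) {x : Fin n → ℝ} {t : ℝ}
    (h : 0 < gap r x t) (j : Fin n) : t ≠ x j :=
  fun h' => h.ne' (gap_eq_zero hr h')

lemma continuous_gap {n : ℕ} {r : Fin n → ℝ} (hr : ∀ j, 0 < r j) :
    Continuous fun p : (Fin n → ℝ) × ℝ => gap r p.1 p.2 := by
  unfold gap
  refine continuous_finsetProd _ fun j _ => ?_
  exact Continuous.rpow_const (by fun_prop) fun _ => Or.inr (hr j).le

/-- Joint upper semicontinuity of `(y, t) ↦ w t * T_y t`. -/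
lemma eventually_mul_gap_lt {n : ℕ} {r : Fin n → ℝ} (hr : ∀ j, 0 < r j) {a b : ℝ} {w : ℝ → ℝ}
    (husc : UpperSemicontinuousOn w (Icc a b)) {x : Fin n → ℝ} {t₀ M : ℝ} (ht₀ : t₀ ∈ Icc a b)
    (h : w t₀ * gap r x t₀ < M) :
    ∀ᶠ p : (Fin n → ℝ) × ℝ in nhds (x, t₀), p.2 ∈ Icc a b → w p.2 * gap r p.1 p.2 < M := by
  obtain ⟨c, hc, hcM⟩ : ∃ c, w t₀ < c ∧ c * gap r x t₀ < M := by
    have hcont : ContinuousAt (fun c : ℝ => c * gap r x t₀) (w t₀) := by fun_prop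
    have h1 : ∀ᶠ c in nhdsWithin (w t₀) (Ioi (w t₀)), c * gap r x t₀ < M :=
      (hcont.eventually (gt_mem_nhds h)).filter_mono nhdsWithin_le_nhds
    obtain ⟨c, h2, h3⟩ := (h1.and self_mem_nhdsWithin).exists
    exact ⟨c, h3, h2⟩
  have h1 : ∀ᶠ t in nhds t₀, t ∈ Icc a b → w t < c :=
    eventually_nhdsWithin_iff.1 (husc t₀ ht₀ c hc)
  have h2 : ∀ᶠ p : (Fin n → ℝ) × ℝ in nhds (x, t₀), c * gap r p.1 p.2 < M :=
    ((continuous_const.mul (continuous_gap hr)).tendsto (x, t₀)).eventually (gt_mem_nhds hcM)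
  filter_upwards [h2, continuous_snd.continuousAt.eventually h1] with p hp2 hp1 hp
  exact (mul_le_mul_of_nonneg_right (hp1 hp).le (gap_nonneg r _ _)).trans_lt hp2

lemma upperSemicontinuousOn_mul_gap {n : ℕ} {r : Fin n → ℝ} (hr : ∀ j, 0 < r j) {a b : ℝ}
    {w : ℝ → ℝ} (husc : UpperSemicontinuousOn w (Icc a b)) (x : Fin n → ℝ) :
    UpperSemicontinuousOn (fun t => w t * gap r x t) (Icc a b) := by
  intro t₀ ht₀ M hM
  refine eventually_nhdsWithin_iff.2 ?_
  exact (Continuous.prodMk_right x).continuousAt.eventually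
    (eventually_mul_gap_lt hr husc ht₀ hM)

lemma mul_gap_le_wnorm {n : ℕ} {r : Fin n → ℝ} (hr : ∀ j, 0 < r j) {a b : ℝ} {w : ℝ → ℝ}
    (husc : UpperSemicontinuousOn w (Icc a b)) (x : Fin n → ℝ) {t : ℝ} (ht : t ∈ Icc a b) :
    w t * gap r x t ≤ wnorm w a b r x :=
  le_csSup ((upperSemicontinuousOn_mul_gap hr husc x).bddAbove_of_isCompact isCompact_Icc)
    (mem_image_of_mem _ ht)

lemma exists_mul_gap_eq_wnorm {n : ℕ} {r : Fin n → ℝ} (hr : ∀ j, 0 < r j) {a b : ℝ} (hab : a < b)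
    {w : ℝ → ℝ} (husc : UpperSemicontinuousOn w (Icc a b)) (x : Fin n → ℝ) :
    ∃ t ∈ Icc a b, w t * gap r x t = wnorm w a b r x := by
  obtain ⟨t, ht, hmax⟩ := (upperSemicontinuousOn_mul_gap hr husc x).exists_isMaxOn
    (nonempty_Icc.2 hab.le) isCompact_Icc
  refine ⟨t, ht, le_antisymm (mul_gap_le_wnorm hr husc x ht) ?_⟩
  refine csSup_le ((nonempty_Icc.2 hab.le).image _) ?_
  rintro _ ⟨s, hs, rfl⟩
  exact hmax hs

lemma wnorm_pos {n : ℕ} {r : Fin n → ℝ} (hr : ∀ j, 0 < r j) {a b : ℝ} {w : ℝ → ℝ}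
    (hw0 : ∀ t ∈ Icc a b, 0 ≤ w t) (husc : UpperSemicontinuousOn w (Icc a b))
    (hcard : weightCardGT w a b n) (x : Fin n → ℝ) : 0 < wnorm w a b r x := by
  obtain ⟨T, hT, hTw, hTn⟩ := hcard
  have h1 : ∑ t ∈ T, (if t = a ∨ t = b then (1/2 : ℝ) else 1) ≤ ∑ t ∈ T, (1 : ℝ) :=
    Finset.sum_le_sum fun t _ => by split_ifs <;> norm_num
  have h2 : n < T.card := by
    have := hTn.trans_le h1
    simp only [Finset.sum_const, nsmul_eq_mul, mul_one] at this
    exact_mod_cast this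
  have h3 : (Finset.univ.image x).card < T.card :=
    (Finset.card_image_le.trans (by simp)).trans_lt h2
  obtain ⟨t, htT, htx⟩ := Finset.exists_mem_notMem_of_card_lt_card h3
  have ht : t ∈ Icc a b := hT htT
  refine lt_of_lt_of_le ?_ (mul_gap_le_wnorm hr husc x ht)
  refine mul_pos (lt_of_le_of_ne (hw0 t ht) (hTw t htT).symm) (gap_pos r fun j hj => htx ?_)
  simp [hj]

lemma isCompact_setOf_adm (a b : ℝ) (n : ℕ) : IsCompact {x : Fin n → ℝ | adm a b x} := by
  have h : {x : Fin n → ℝ | adm a b x} = {x | Monotone x} ∩ Set.univ.pi fun _ => Icc a b := by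
    ext x
    simp only [adm, mem_ofPred_eq, mem_inter_iff, Set.mem_pi, mem_univ, true_imp_iff]
  rw [h, inter_comm]
  refine (isCompact_univ_pi fun _ => isCompact_Icc).inter_right ?_
  exact isClosed_monotone

lemma exists_wnorm_minimizer {n : ℕ} {r : Fin n → ℝ} (hr : ∀ j, 0 < r j) {a b : ℝ} (hab : a < b)
    {w : ℝ → ℝ} (husc : UpperSemicontinuousOn w (Icc a b)) :
    ∃ x : Fin n → ℝ, adm a b x ∧ ∀ y, adm a b y → wnorm w a b r x ≤ wnorm w a b r y := by
  have hlsc : LowerSemicontinuousOn (wnorm w a b r) {x : Fin n → ℝ | adm a b x} := by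
    intro x _ c hc
    obtain ⟨t, ht, hxt⟩ := exists_mul_gap_eq_wnorm hr hab husc x
    have hcont : Continuous fun y : Fin n → ℝ => w t * gap r y t :=
      continuous_const.mul ((continuous_gap hr).comp (Continuous.prodMk_left t))
    have h1 : ∀ᶠ y in nhds x, c < w t * gap r y t :=
      (hcont.tendsto x).eventually (lt_mem_nhds (by rw [hxt]; exact hc))
    filter_upwards [h1.filter_mono nhdsWithin_le_nhds] with y hy
    exact hy.trans_le (mul_gap_le_wnorm hr husc y ht)
  obtain ⟨x, hx, hmin⟩ := hlsc.exists_isMinOn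
    ⟨fun _ => a, show adm a b _ from ⟨monotone_const, fun _ => left_mem_Icc.2 hab.le⟩⟩ (isCompact_setOf_adm a b n)
  exact ⟨x, hx, fun y hy => hmin hy⟩

/-- Two maximum points of `w * T_x` are separated by a node when `w` is log-concave. -/
lemma exists_node_between {n : ℕ} (hn : 0 < n) {r : Fin n → ℝ} (hr : ∀ j, 0 < r j) {a b : ℝ}
    {w : ℝ → ℝ} (hw0 : ∀ t ∈ Icc a b, 0 ≤ w t) (husc : UpperSemicontinuousOn w (Icc a b))
    (hlogconc : ∀ t₁ ∈ Icc a b, ∀ t₂ ∈ Icc a b, ∀ l ∈ Icc (0:ℝ) 1,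
      w t₁ ^ l * w t₂ ^ (1 - l) ≤ w (l * t₁ + (1 - l) * t₂))
    {x : Fin n → ℝ} (hpos : 0 < wnorm w a b r x) {s t : ℝ} (hs : s ∈ Icc a b) (ht : t ∈ Icc a b)
    (hst : s < t) (hxs : w s * gap r x s = wnorm w a b r x)
    (hxt : w t * gap r x t = wnorm w a b r x) : ∃ j, s < x j ∧ x j < t := by
  by_contra! hno
  have hws := hw0 s hs
  have hwt := hw0 t ht
  have hgs : 0 < gap r x s := pos_of_mul_pos_right (hxs ▸ hpos) hws
  have hgt : 0 < gap r x t := pos_of_mul_pos_right (hxt ▸ hpos) hwt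
  have hws' : 0 < w s := pos_of_mul_pos_left (hxs ▸ hpos) hgs.le
  have hwt' : 0 < w t := pos_of_mul_pos_left (hxt ▸ hpos) hgt.le
  have hm : (s + t) / 2 ∈ Icc a b := ⟨by linarith [hs.1, ht.1], by linarith [hs.2, ht.2]⟩
  have h1 : w s * w t ≤ w ((s + t) / 2) ^ 2 := by
    have h := hlogconc s hs t ht (1 / 2) ⟨by norm_num, by norm_num⟩
    rw [show (1 : ℝ) - 1 / 2 = 1 / 2 by norm_num, show 1 / 2 * s + 1 / 2 * t = (s + t) / 2 by ring,
      ← Real.mul_rpow hws hwt, ← Real.sqrt_eq_rpow] at h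
    exact (Real.sqrt_le_left (hw0 _ hm)).1 h
  have h2 : gap r x s * gap r x t < gap r x ((s + t) / 2) ^ 2 := by
    unfold gap
    rw [← Finset.prod_mul_distrib, ← Finset.prod_pow]
    have key : ∀ j, (|s - x j| ^ r j * |t - x j| ^ r j) < (|(s + t) / 2 - x j| ^ r j) ^ 2 := by
      intro j
      rw [← Real.mul_rpow (abs_nonneg _) (abs_nonneg _), sq,
        ← Real.mul_rpow (abs_nonneg _) (abs_nonneg _), ← abs_mul, ← abs_mul]
      refine Real.rpow_lt_rpow (abs_nonneg _) ?_ (hr j)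
      have hsj := ne_node_of_gap_pos hr hgs j
      have hst2 : 0 < (t - s) ^ 2 := by have := sub_pos.2 hst; positivity
      rcases lt_or_gt_of_ne hsj with h | h
      · have h' := hno j h
        rw [abs_of_nonneg (mul_nonneg_of_nonpos_of_nonpos (by linarith) (by linarith)),
          abs_of_nonneg (mul_self_nonneg _)]
        nlinarith
      · rw [abs_of_nonneg (mul_nonneg (by linarith) (by linarith)),
          abs_of_nonneg (mul_self_nonneg _)]
        nlinarith
    refine Finset.prod_lt_prod (fun j _ => ?_) (fun j _ => (key j).le)
      ⟨⟨0, hn⟩, Finset.mem_univ _, key _⟩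
    have hsj := abs_pos.2 (sub_ne_zero.2 (ne_node_of_gap_pos hr hgs j))
    have htj := abs_pos.2 (sub_ne_zero.2 (ne_node_of_gap_pos hr hgt j))
    positivity
  have h3 : (w s * w t) * (gap r x s * gap r x t)
      < w ((s + t) / 2) ^ 2 * gap r x ((s + t) / 2) ^ 2 :=
    (mul_lt_mul_of_pos_left h2 (mul_pos hws' hwt')).trans_le
      (mul_le_mul_of_nonneg_right h1 (sq_nonneg _))
  have h4 := mul_gap_le_wnorm hr husc x hm
  have h5 : 0 ≤ w ((s + t) / 2) * gap r x ((s + t) / 2) :=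
    mul_nonneg (hw0 _ hm) (gap_nonneg _ _ _)
  have h6 : (w s * w t) * (gap r x s * gap r x t) = wnorm w a b r x * wnorm w a b r x := by
    rw [mul_mul_mul_comm, hxs, hxt]
  rw [h6] at h3
  nlinarith

/-- `t` interlaces the nodes `x` and consists of maximum points of `w * T_x`. -/
structure Equioscillates (w : ℝ → ℝ) (a b : ℝ) {n : ℕ} (r x : Fin n → ℝ) (t : Fin (n + 1) → ℝ) :
    Prop where
  mem : ∀ k, t k ∈ Icc a b
  mono : StrictMono t
  left : ∀ k : Fin n, t k.castSucc < x k
  right : ∀ k : Fin n, x k < t k.succ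
  eq : ∀ k, w (t k) * gap r x (t k) = wnorm w a b r x

lemma equioscillates_of_eq {n : ℕ} (hn : 0 < n) {r : Fin n → ℝ} (hr : ∀ j, 0 < r j) {a b : ℝ}
    {w : ℝ → ℝ} (hw0 : ∀ t ∈ Icc a b, 0 ≤ w t) (husc : UpperSemicontinuousOn w (Icc a b))
    (hlogconc : ∀ t₁ ∈ Icc a b, ∀ t₂ ∈ Icc a b, ∀ l ∈ Icc (0:ℝ) 1,
      w t₁ ^ l * w t₂ ^ (1 - l) ≤ w (l * t₁ + (1 - l) * t₂))
    {x : Fin n → ℝ} (hx : Monotone x) (hpos : 0 < wnorm w a b r x) {t : Fin (n + 1) → ℝ}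
    (ht : StrictMono t) (hta : a ≤ t 0) (htb : t (Fin.last n) ≤ b)
    (heq : ∀ k, w (t k) * gap r x (t k) = wnorm w a b r x) :
    Equioscillates w a b r x t := by
  have hmem : ∀ k, t k ∈ Icc a b := fun k =>
    ⟨hta.trans (ht.monotone (Fin.zero_le k)), (ht.monotone (Fin.le_last k)).trans htb⟩
  have hsep : ∀ k : Fin n, ∃ j, t k.castSucc < x j ∧ x j < t k.succ := fun k =>
    exists_node_between hn hr hw0 husc hlogconc hpos (hmem _) (hmem _)
      (ht Fin.castSucc_lt_succ) (heq _) (heq _)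
  choose σ hσ1 hσ2 using hsep
  have hσ : StrictMono σ := by
    intro k l hkl
    have h1 : t k.succ ≤ t l.castSucc := ht.monotone (Fin.succ_le_castSucc_iff.2 hkl)
    by_contra! h
    linarith [hx h, hσ2 k, hσ1 l]
  have hid : ∀ k, σ k = k := fun k => le_antisymm hσ.apply_le hσ.le_apply
  exact ⟨hmem, ht, fun k => by simpa [hid] using hσ1 k, fun k => by simpa [hid] using hσ2 k, heq⟩

/-- Log-concavity in the form of a four point inequality. -/
lemma mul_le_mul_of_logconcave {a b : ℝ} {w : ℝ → ℝ} (hw0 : ∀ t ∈ Icc a b, 0 ≤ w t)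
    (hlogconc : ∀ t₁ ∈ Icc a b, ∀ t₂ ∈ Icc a b, ∀ l ∈ Icc (0:ℝ) 1,
      w t₁ ^ l * w t₂ ^ (1 - l) ≤ w (l * t₁ + (1 - l) * t₂))
    {s t h : ℝ} (hs : s ∈ Icc a b) (ht : t ∈ Icc a b) (hst : s < t) (h0 : 0 ≤ h)
    (hh : s + h ≤ t) : w s * w t ≤ w (s + h) * w (t - h) := by
  have hd : 0 < t - s := by linarith
  have hl : h / (t - s) ∈ Icc (0 : ℝ) 1 :=
    ⟨by positivity, (div_le_one hd).2 (by linarith)⟩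
  have hws := hw0 s hs
  have hwt := hw0 t ht
  have e1 := hlogconc t ht s hs _ hl
  have e2 := hlogconc s hs t ht _ hl
  have he : h / (t - s) * (t - s) = h := div_mul_cancel₀ _ hd.ne'
  rw [show h / (t - s) * t + (1 - h / (t - s)) * s = s + h by linear_combination he] at e1
  rw [show h / (t - s) * s + (1 - h / (t - s)) * t = t - h by linear_combination -he] at e2
  have hpow : ∀ z : ℝ, 0 ≤ z → z ^ (h / (t - s)) * z ^ (1 - h / (t - s)) = z := fun z hz => by
    rw [← Real.rpow_add_of_nonneg hz hl.1 (by linarith [hl.2])]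
    simp
  calc w s * w t = (w t ^ (h / (t - s)) * w s ^ (1 - h / (t - s))) *
        (w s ^ (h / (t - s)) * w t ^ (1 - h / (t - s))) := by
        conv_lhs => rw [← hpow _ hws, ← hpow _ hwt]
        ring
    _ ≤ _ := mul_le_mul e1 e2 (by positivity) (hw0 _ ⟨by linarith [hs.1], by linarith [ht.2]⟩)

lemma Equioscillates.pos {n : ℕ} {r : Fin n → ℝ} {a b : ℝ} {w : ℝ → ℝ} {x : Fin n → ℝ}
    {t : Fin (n + 1) → ℝ} (ht : Equioscillates w a b r x t) (hpos : 0 < wnorm w a b r x)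
    (k : Fin (n + 1)) : 0 < w (t k) :=
  pos_of_mul_pos_left (ht.eq k ▸ hpos) (gap_nonneg _ _ _)

lemma Equioscillates.le {n : ℕ} (hn : 0 < n) {r : Fin n → ℝ} (hr : ∀ j, 0 < r j) {a b : ℝ}
    {w : ℝ → ℝ} (hw0 : ∀ t ∈ Icc a b, 0 ≤ w t) (husc : UpperSemicontinuousOn w (Icc a b))
    (hlogconc : ∀ t₁ ∈ Icc a b, ∀ t₂ ∈ Icc a b, ∀ l ∈ Icc (0:ℝ) 1,
      w t₁ ^ l * w t₂ ^ (1 - l) ≤ w (l * t₁ + (1 - l) * t₂))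
    {x y : Fin n → ℝ} (hxpos : 0 < wnorm w a b r x) (hypos : 0 < wnorm w a b r y)
    {t s : Fin (n + 1) → ℝ} (ht : Equioscillates w a b r x t) (hs : Equioscillates w a b r y s)
    (j : Fin n) : y j ≤ x j := by
  have : Nonempty (Fin n) := ⟨⟨0, hn⟩⟩
  by_contra! hj
  obtain ⟨p, hp⟩ := Finite.exists_max fun i => y i - x i
  set h := y p - x p with hh
  have h0 : 0 < h := by linarith [hp j]
  by_cases hall : ∀ i, y i - x i = h
  · have e1 : wnorm w a b r x < wnorm w a b r y := by
      rw [← ht.eq 0]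
      refine lt_of_lt_of_le ?_ (mul_gap_le_wnorm hr husc y (ht.mem 0))
      refine mul_lt_mul_of_pos_left ?_ (ht.pos hxpos 0)
      have hlt : ∀ i, |t 0 - x i| ^ r i < |t 0 - y i| ^ r i ∧ 0 < |t 0 - x i| := fun i => by
        have h1 : t 0 < x i := (ht.mono.monotone (Fin.zero_le _)).trans_lt (ht.left i)
        have h2 := hall i
        rw [abs_of_neg (by linarith), abs_of_neg (by linarith)]
        exact ⟨Real.rpow_lt_rpow (by linarith) (by linarith) (hr i), by linarith⟩
      exact Finset.prod_lt_prod (fun i _ => Real.rpow_pos_of_pos (hlt i).2 _)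
        (fun i _ => (hlt i).1.le) ⟨p, Finset.mem_univ _, (hlt p).1⟩
    have e2 : wnorm w a b r y < wnorm w a b r x := by
      rw [← hs.eq (Fin.last n)]
      refine lt_of_lt_of_le ?_ (mul_gap_le_wnorm hr husc x (hs.mem (Fin.last n)))
      refine mul_lt_mul_of_pos_left ?_ (hs.pos hypos _)
      have hlt : ∀ i, |s (Fin.last n) - y i| ^ r i < |s (Fin.last n) - x i| ^ r i ∧
          0 < |s (Fin.last n) - y i| := fun i => by
        have h1 : y i < s (Fin.last n) :=
          (hs.right i).trans_le (hs.mono.monotone (Fin.le_last _))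
        have h2 := hall i
        rw [abs_of_pos (by linarith), abs_of_pos (by linarith)]
        exact ⟨Real.rpow_lt_rpow (by linarith) (by linarith) (hr i), by linarith⟩
      exact Finset.prod_lt_prod (fun i _ => Real.rpow_pos_of_pos (hlt i).2 _)
        (fun i _ => (hlt i).1.le) ⟨p, Finset.mem_univ _, (hlt p).1⟩
    linarith
  push Not at hall
  obtain ⟨q, hq⟩ := hall
  have hq' : y q - x q < h := lt_of_le_of_ne (hp q) hq
  set α := t p.castSucc with hα
  set β := s p.succ with hβ
  have a1 : α < x p := ht.left p
  have b1 : y p < β := hs.right p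
  have hα' := ht.mem p.castSucc
  have hβ' := hs.mem p.succ
  rw [← hα] at hα'
  rw [← hβ] at hβ'
  have hw : w α * w β ≤ w (α + h) * w (β - h) :=
    mul_le_mul_of_logconcave hw0 hlogconc hα' hβ' (by linarith) h0.le (by linarith)
  have hlt : ∀ i, (0 < |α - x i| ∧ 0 < |β - y i|) ∧
      |α - x i| * |β - y i| ≤ |α + h - y i| * |β - h - x i| ∧
      (i = q → |α - x i| * |β - y i| < |α + h - y i| * |β - h - x i|) := by
    intro i
    have hpi := hp i
    have hprod : 0 ≤ (β - α - h) * (h - (y i - x i)) := mul_nonneg (by linarith) (by linarith)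
    have hprod' : i = q → 0 < (β - α - h) * (h - (y i - x i)) := by
      rintro rfl
      exact mul_pos (by linarith) (by linarith)
    rcases lt_trichotomy i p with hip | rfl | hip
    · have h1 : x i < α := (ht.right i).trans_le
        (ht.mono.monotone (Fin.succ_le_castSucc_iff.2 hip))
      rw [abs_of_pos (by linarith : 0 < α - x i), abs_of_pos (by linarith : 0 < β - y i),
        abs_of_pos (by linarith : 0 < α + h - y i), abs_of_pos (by linarith : 0 < β - h - x i)]
      refine ⟨⟨by linarith, by linarith⟩, by nlinarith, fun hi => ?_⟩
      have := hprod' hi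
      nlinarith
    · refine ⟨⟨abs_pos.2 (by linarith), abs_pos.2 (by linarith)⟩, le_of_eq ?_, ?_⟩
      · congr 2 <;> rw [hh] <;> ring
      · rintro rfl
        linarith
    · have h1 : β < y i := (hs.mono.monotone (Fin.succ_le_castSucc_iff.2 hip)).trans_lt (hs.left i)
      rw [abs_of_neg (by linarith : α - x i < 0), abs_of_neg (by linarith : β - y i < 0),
        abs_of_neg (by linarith : α + h - y i < 0), abs_of_neg (by linarith : β - h - x i < 0)]
      refine ⟨⟨by linarith, by linarith⟩, by nlinarith, fun hi => ?_⟩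
      have := hprod' hi
      nlinarith
  have hgap : gap r x α * gap r y β < gap r y (α + h) * gap r x (β - h) := by
    unfold gap
    rw [← Finset.prod_mul_distrib, ← Finset.prod_mul_distrib]
    refine Finset.prod_lt_prod (fun i _ => ?_) (fun i _ => ?_) ⟨q, Finset.mem_univ _, ?_⟩
    · have h1 := (hlt i).1.1
      have h2 := (hlt i).1.2
      positivity
    · rw [← Real.mul_rpow (abs_nonneg _) (abs_nonneg _),
        ← Real.mul_rpow (abs_nonneg _) (abs_nonneg _)]
      exact Real.rpow_le_rpow (by positivity) (hlt i).2.1 (hr i).le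
    · rw [← Real.mul_rpow (abs_nonneg _) (abs_nonneg _),
        ← Real.mul_rpow (abs_nonneg _) (abs_nonneg _)]
      exact Real.rpow_lt_rpow (by positivity) ((hlt q).2.2 rfl) (hr q)
  have m1 : α + h ∈ Icc a b := ⟨by linarith [hα'.1], by linarith [hβ'.2]⟩
  have m2 : β - h ∈ Icc a b := ⟨by linarith [hα'.1], by linarith [hβ'.2]⟩
  have f1 : (w α * w β) * (gap r x α * gap r y β) = wnorm w a b r x * wnorm w a b r y := by
    rw [mul_mul_mul_comm, ht.eq, hs.eq]
  have f2 : (w (α + h) * w (β - h)) * (gap r y (α + h) * gap r x (β - h))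
      ≤ wnorm w a b r y * wnorm w a b r x := by
    rw [mul_mul_mul_comm]
    exact mul_le_mul (mul_gap_le_wnorm hr husc y m1) (mul_gap_le_wnorm hr husc x m2)
      (mul_nonneg (hw0 _ m2) (gap_nonneg _ _ _)) hypos.le
  have f3 := mul_lt_mul_of_pos_left hgap (mul_pos (ht.pos hxpos p.castSucc) (hs.pos hypos p.succ))
  have f4 := mul_le_mul_of_nonneg_right hw
    (mul_nonneg (gap_nonneg r y (α + h)) (gap_nonneg r x (β - h)))
  rw [← hα, ← hβ] at f3
  linarith

lemma eventually_adm {n : ℕ} {a b : ℝ} {x v : Fin n → ℝ} (hx : adm a b x)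
    (hv : ∀ i k, i ≤ k → x i = x k → v i ≤ v k) (hva : ∀ i, x i = a → 0 ≤ v i)
    (hvb : ∀ i, x i = b → v i ≤ 0) :
    ∀ᶠ s in nhdsWithin (0 : ℝ) (Ioi 0), adm a b fun i => x i + s * v i := by
  have hlt : ∀ c d u u' : ℝ, c < d →
      ∀ᶠ s in nhdsWithin (0 : ℝ) (Ioi 0), c + s * u < d + s * u' := fun c d u u' hcd => by
    have h1 : Continuous fun s : ℝ => c + s * u := by fun_prop
    have h2 : Continuous fun s : ℝ => d + s * u' := by fun_prop
    exact ((isOpen_lt h1 h2).eventually_mem (by simpa using hcd)).filter_mono nhdsWithin_le_nhds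
  have hle : ∀ c d u u' : ℝ, c ≤ d → (c = d → u ≤ u') →
      ∀ᶠ s in nhdsWithin (0 : ℝ) (Ioi 0), c + s * u ≤ d + s * u' := fun c d u u' hcd h => by
    rcases hcd.lt_or_eq with hcd | hcd
    · exact (hlt c d u u' hcd).mono fun _ => le_of_lt
    · filter_upwards [self_mem_nhdsWithin] with s hs
      rw [hcd]
      have := mul_le_mul_of_nonneg_left (h hcd) (le_of_lt hs)
      linarith
  have h1 : ∀ᶠ s in nhdsWithin (0 : ℝ) (Ioi 0), ∀ i k, i ≤ k → x i + s * v i ≤ x k + s * v k := by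
    refine eventually_all.2 fun i => eventually_all.2 fun k => ?_
    by_cases hik : i ≤ k
    · exact (hle _ _ _ _ (hx.1 hik) (hv i k hik)).mono fun s hs _ => hs
    · exact Eventually.of_forall fun s h => absurd h hik
  have h2 : ∀ᶠ s in nhdsWithin (0 : ℝ) (Ioi 0), ∀ i, a + s * 0 ≤ x i + s * v i :=
    eventually_all.2 fun i => hle _ _ _ _ (hx.2 i).1 fun h => hva i h.symm
  have h3 : ∀ᶠ s in nhdsWithin (0 : ℝ) (Ioi 0), ∀ i, x i + s * v i ≤ b + s * 0 :=
    eventually_all.2 fun i => hle _ _ _ _ (hx.2 i).2 fun h => hvb i h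
  filter_upwards [h1, h2, h3] with s h1 h2 h3
  exact ⟨fun i k => h1 i k, fun i => ⟨by simpa using h2 i, by simpa using h3 i⟩⟩

lemma gap_add_smul_lt {n : ℕ} {r : Fin n → ℝ} (hr : ∀ j, 0 < r j) {x v : Fin n → ℝ} {s t : ℝ}
    (hs : 0 < s) (hv : ∃ i, v i ≠ 0) (hne : ∀ i, t ≠ x i)
    (hpos : ∀ i, 0 < 1 - s * v i / (t - x i)) (hsum : 0 ≤ ∑ i, r i * v i / (t - x i)) :
    gap r (fun i => x i + s * v i) t < gap r x t := by
  have hne' : ∀ i, t - x i ≠ 0 := fun i => sub_ne_zero.2 (hne i)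
  have hfac : ∀ i, |t - (x i + s * v i)| ^ r i =
      |t - x i| ^ r i * (1 - s * v i / (t - x i)) ^ r i := fun i => by
    rw [← Real.mul_rpow (abs_nonneg _) (hpos i).le]
    congr 1
    conv_rhs => rw [← abs_of_pos (hpos i), ← abs_mul]
    congr 1
    have := hne' i
    field_simp
    ring
  have hgap : gap r (fun i => x i + s * v i) t =
      gap r x t * ∏ i, (1 - s * v i / (t - x i)) ^ r i := by
    unfold gap
    rw [← Finset.prod_mul_distrib]
    exact Finset.prod_congr rfl fun i _ => hfac i
  rw [hgap]
  refine mul_lt_of_lt_one_right (gap_pos r hne) ?_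
  have hexp : ∏ i, Real.exp (-(s * v i / (t - x i))) ^ r i ≤ 1 := by
    have : ∀ i, Real.exp (-(s * v i / (t - x i))) ^ r i =
        Real.exp (-s * (r i * v i / (t - x i))) := fun i => by
      rw [← Real.exp_mul]
      congr 1
      ring
    simp only [this]
    rw [← Real.exp_sum, ← Finset.mul_sum]
    exact Real.exp_le_one_iff.2 (by nlinarith)
  refine lt_of_lt_of_le ?_ hexp
  obtain ⟨p, hp⟩ := hv
  refine Finset.prod_lt_prod (fun i _ => Real.rpow_pos_of_pos (hpos i) _) (fun i _ => ?_)
    ⟨p, Finset.mem_univ _, ?_⟩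
  · refine Real.rpow_le_rpow (hpos i).le ?_ (hr i).le
    have := Real.add_one_le_exp (-(s * v i / (t - x i)))
    linarith
  · refine Real.rpow_lt_rpow (hpos p).le ?_ (hr p)
    have := Real.add_one_lt_exp (x := -(s * v p / (t - x p)))
      (neg_ne_zero.2 (div_ne_zero (mul_ne_zero hs.ne' hp) (hne' p)))
    linarith

/-- A feasible direction that does not increase `T_x` near the maximum points of `w * T_x`
is a direction of descent for the norm. -/
lemma exists_wnorm_lt_of_direction {n : ℕ} {r : Fin n → ℝ} (hr : ∀ j, 0 < r j) {a b : ℝ}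
    (hab : a < b) {w : ℝ → ℝ} (hw0 : ∀ t ∈ Icc a b, 0 ≤ w t)
    (husc : UpperSemicontinuousOn w (Icc a b)) {x v : Fin n → ℝ} (hx : adm a b x)
    (hpos : 0 < wnorm w a b r x)
    (hv : ∀ i k, i ≤ k → x i = x k → v i ≤ v k) (hva : ∀ i, x i = a → 0 ≤ v i)
    (hvb : ∀ i, x i = b → v i ≤ 0) (hv0 : ∃ i, v i ≠ 0)
    (hdir : ∀ t ∈ Icc a b, w t * gap r x t = wnorm w a b r x →
      ∀ᶠ t' in nhds t, 0 ≤ ∑ i, r i * v i / (t' - x i)) :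
    ∃ y, adm a b y ∧ wnorm w a b r y < wnorm w a b r x := by
  have hloc : ∀ t ∈ Icc a b, ∀ᶠ p : ℝ × ℝ in nhds (0, t), p.2 ∈ Icc a b → 0 < p.1 →
      w p.2 * gap r (fun i => x i + p.1 * v i) p.2 < wnorm w a b r x := by
    intro t ht
    rcases (mul_gap_le_wnorm hr husc x ht).lt_or_eq with hlt | heq
    · have hcont : Continuous fun p : ℝ × ℝ =>
          (((fun i => x i + p.1 * v i) : Fin n → ℝ), p.2) := by fun_prop
      have hev := eventually_mul_gap_lt hr husc ht hlt
      have hcont' := hcont.tendsto (0, t)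
      simp only [zero_mul, add_zero] at hcont'
      exact (hcont'.eventually hev).mono fun p hp h _ => hp h
    · have hgpos : 0 < gap r x t := pos_of_mul_pos_right (heq ▸ hpos) (hw0 t ht)
      have hne := ne_node_of_gap_pos hr hgpos
      have h1 : ∀ᶠ p : ℝ × ℝ in nhds (0, t), ∀ i, p.2 ≠ x i :=
        eventually_all.2 fun i =>
          (continuous_snd.tendsto ((0 : ℝ), t)).eventually (isOpen_ne.eventually_mem (hne i))
      have h2 : ∀ᶠ p : ℝ × ℝ in nhds (0, t), ∀ i, 0 < 1 - p.1 * v i / (p.2 - x i) := by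
        refine eventually_all.2 fun i => ?_
        have hc : ContinuousAt (fun p : ℝ × ℝ => 1 - p.1 * v i / (p.2 - x i)) (0, t) := by
          refine ContinuousAt.sub (by fun_prop) (ContinuousAt.div (by fun_prop) (by fun_prop) ?_)
          exact sub_ne_zero.2 (hne i)
        exact hc.eventually (lt_mem_nhds (by simp))
      have h3 := (continuous_snd.tendsto ((0 : ℝ), t)).eventually (hdir t ht heq)
      filter_upwards [h1, h2, h3] with p h1 h2 h3 hp hs
      have hlt := gap_add_smul_lt hr hs hv0 h1 h2 h3
      rcases (hw0 _ hp).eq_or_lt with hw | hw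
      · rw [← hw, zero_mul]
        exact hpos
      · exact (mul_lt_mul_of_pos_left hlt hw).trans_le (mul_gap_le_wnorm hr husc x hp)
  have hall : ∀ᶠ s in nhds (0 : ℝ), ∀ t ∈ Icc a b, t ∈ Icc a b → 0 < s →
      w t * gap r (fun i => x i + s * v i) t < wnorm w a b r x :=
    isCompact_Icc.eventually_forall_of_forall_eventually hloc
  obtain ⟨s, ⟨hs1, hs2⟩, hs0⟩ := ((hall.filter_mono nhdsWithin_le_nhds).and
    (eventually_adm hx hv hva hvb)).and self_mem_nhdsWithin |>.exists
  refine ⟨_, hs2, ?_⟩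
  obtain ⟨t, ht, hteq⟩ := exists_mul_gap_eq_wnorm hr hab husc fun i => x i + s * v i
  rw [← hteq]
  exact hs1 t ht ht hs0

/-- If no maximum point lies between two consecutive nodes (or endpoints) `L ≤ R`, spreading
the nodes at `L` and `R` apart decreases the norm. -/
lemma exists_wnorm_lt_of_empty_gap {n : ℕ} {r : Fin n → ℝ} (hr : ∀ j, 0 < r j) {a b : ℝ}
    (hab : a < b) {w : ℝ → ℝ} (hw0 : ∀ t ∈ Icc a b, 0 ≤ w t)
    (husc : UpperSemicontinuousOn w (Icc a b)) {x : Fin n → ℝ} (hx : adm a b x)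
    (hpos : 0 < wnorm w a b r x) (j : ℕ) {L R : ℝ} (hLR : L ≤ R)
    (hL : L = a ∨ ∃ i : Fin n, i.val < j ∧ x i = L)
    (hR : R = b ∨ ∃ i : Fin n, j ≤ i.val ∧ x i = R)
    (hempty : ∀ t ∈ Icc L R, w t * gap r x t ≠ wnorm w a b r x) :
    ∃ y, adm a b y ∧ wnorm w a b r y < wnorm w a b r x := by
  classical
  set SL : Finset (Fin n) := {i | i.val < j ∧ x i = L} with hSL
  set SR : Finset (Fin n) := {i | j ≤ i.val ∧ x i = R} with hSR
  set α : ℝ := if L = a then 0 else (∑ i ∈ SL, r i)⁻¹ with hα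
  set β : ℝ := if R = b then 0 else (∑ i ∈ SR, r i)⁻¹ with hβ
  have hPnn : 0 ≤ ∑ i ∈ SL, r i := Finset.sum_nonneg fun i _ => (hr i).le
  have hQnn : 0 ≤ ∑ i ∈ SR, r i := Finset.sum_nonneg fun i _ => (hr i).le
  have hP : L ≠ a → 0 < ∑ i ∈ SL, r i := fun h => by
    obtain ⟨i, hi⟩ := hL.resolve_left h
    exact Finset.sum_pos (fun i _ => hr i) ⟨i, by simp [hSL, hi]⟩
  have hQ : R ≠ b → 0 < ∑ i ∈ SR, r i := fun h => by
    obtain ⟨i, hi⟩ := hR.resolve_left h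
    exact Finset.sum_pos (fun i _ => hr i) ⟨i, by simp [hSR, hi]⟩
  have hα0 : 0 ≤ α := by rw [hα]; split_ifs <;> positivity
  have hβ0 : 0 ≤ β := by rw [hβ]; split_ifs <;> positivity
  have hPα1 : (∑ i ∈ SL, r i) * α ≤ 1 := by
    rw [hα]; split_ifs with h
    · simp
    · rw [mul_inv_cancel₀ (hP h).ne']
  have hQβ1 : (∑ i ∈ SR, r i) * β ≤ 1 := by
    rw [hβ]; split_ifs with h
    · simp
    · rw [mul_inv_cancel₀ (hQ h).ne']
  set v : Fin n → ℝ := fun i =>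
    (if i ∈ SL then -α else 0) + (if i ∈ SR then β else 0) with hv
  have hdisj : ∀ i, i ∈ SL → i ∉ SR := fun i h1 h2 => by
    simp only [hSL, hSR, Finset.mem_filter, Finset.mem_univ, true_and] at h1 h2
    omega
  have hsum : ∀ t, ∑ i, r i * v i / (t - x i) =
      ((∑ i ∈ SR, r i) * β) / (t - R) - ((∑ i ∈ SL, r i) * α) / (t - L) := by
    intro t
    have e1 : ∀ i, r i * v i / (t - x i) =
        (if i ∈ SR then r i * β / (t - R) else 0) - (if i ∈ SL then r i * α / (t - L) else 0) := by
      intro i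
      by_cases h1 : i ∈ SL
      · have hxi : x i = L := by simpa [hSL] using (Finset.mem_filter.1 h1).2.2
        simp only [hv, h1, hdisj i h1, if_true, if_false, hxi]
        ring
      · by_cases h2 : i ∈ SR
        · have hxi : x i = R := by simpa [hSR] using (Finset.mem_filter.1 h2).2.2
          simp only [hv, h1, h2, if_true, if_false, hxi]
          ring
        · simp [hv, h1, h2]
    simp only [e1]
    rw [Finset.sum_sub_distrib, Finset.sum_ite_mem, Finset.sum_ite_mem, Finset.univ_inter,
      Finset.univ_inter, Finset.sum_mul, Finset.sum_mul, Finset.sum_div, Finset.sum_div]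
  refine exists_wnorm_lt_of_direction hr hab hw0 husc hx hpos (v := v) ?_ ?_ ?_ ?_ ?_
  · intro i k hik hxik
    have hik' : i.val ≤ k.val := hik
    simp only [hv, hSL, hSR, Finset.mem_filter, Finset.mem_univ, true_and, hxik]
    split_ifs <;> first | linarith | grind
  · intro i hi
    simp only [hv, hSL, Finset.mem_filter, Finset.mem_univ, true_and]
    have : ¬ (i.val < j ∧ x i = L) ∨ α = 0 := by
      by_cases h : i.val < j ∧ x i = L
      · right
        rw [hα, if_pos (h.2.symm.trans hi)]
      · exact Or.inl h
    rcases this with h | h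
    · rw [if_neg h]; split_ifs <;> linarith
    · rw [h]; split_ifs <;> linarith
  · intro i hi
    simp only [hv, hSR, Finset.mem_filter, Finset.mem_univ, true_and]
    have : ¬ (j ≤ i.val ∧ x i = R) ∨ β = 0 := by
      by_cases h : j ≤ i.val ∧ x i = R
      · right
        rw [hβ, if_pos (h.2.symm.trans hi)]
      · exact Or.inl h
    rcases this with h | h
    · rw [if_neg h]; split_ifs <;> linarith
    · rw [h]; split_ifs <;> linarith
  · by_cases hLa : L = a
    · by_cases hRb' : R = b
      · obtain ⟨t, ht, hteq⟩ := exists_mul_gap_eq_wnorm hr hab husc x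
        exact absurd hteq (hempty t (by rwa [hLa, hRb']))
      · obtain ⟨i, hi⟩ := hR.resolve_left hRb'
        have hiR : i ∈ SR := by simp [hSR, hi]
        have hiL : i ∉ SL := fun h => hdisj i h hiR
        refine ⟨i, ?_⟩
        simp only [hv, hiR, hiL, if_true, if_false, zero_add, hβ, hRb']
        exact (inv_pos.2 (hQ hRb')).ne'
    · obtain ⟨i, hi⟩ := hL.resolve_left hLa
      have hiL : i ∈ SL := by simp [hSL, hi]
      refine ⟨i, ?_⟩
      simp only [hv, hiL, hdisj i hiL, if_true, if_false, add_zero, hα, hLa]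
      exact neg_ne_zero.2 (inv_pos.2 (hP hLa)).ne'
  · intro t ht hteq
    have htLR : t < L ∨ R < t := by
      by_contra! h
      exact hempty t h hteq
    rcases htLR with h | h
    · have hPα : (∑ i ∈ SL, r i) * α = 1 := by
        have hLa : L ≠ a := (ht.1.trans_lt h).ne'
        rw [hα, if_neg hLa, mul_inv_cancel₀ (hP hLa).ne']
      filter_upwards [isOpen_Iio.eventually_mem h] with t' ht'
      have ht'' : t' < L := ht'
      rw [hsum, hPα, ← neg_sub R t', ← neg_sub L t', div_neg, div_neg]
      have h1 : (∑ i ∈ SR, r i) * β / (R - t') ≤ 1 / (L - t') :=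
        div_le_div₀ zero_le_one hQβ1 (by linarith) (by linarith)
      linarith
    · have hQβ : (∑ i ∈ SR, r i) * β = 1 := by
        have hRb' : R ≠ b := (h.trans_le ht.2).ne
        rw [hβ, if_neg hRb', mul_inv_cancel₀ (hQ hRb').ne']
      filter_upwards [isOpen_Ioi.eventually_mem h] with t' ht'
      have ht'' : R < t' := ht'
      rw [hsum, hQβ]
      have h1 : (∑ i ∈ SL, r i) * α / (t' - L) ≤ 1 / (t' - R) :=
        div_le_div₀ zero_le_one hPα1 (by linarith) (by linarith)
      linarith

lemma exists_max_points_of_minimizer {n : ℕ} {r : Fin n → ℝ} (hr : ∀ j, 0 < r j) {a b : ℝ}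
    (hab : a < b) {w : ℝ → ℝ} (hw0 : ∀ t ∈ Icc a b, 0 ≤ w t)
    (husc : UpperSemicontinuousOn w (Icc a b)) {x : Fin n → ℝ} (hx : adm a b x)
    (hpos : 0 < wnorm w a b r x)
    (hmin : ∀ y, adm a b y → wnorm w a b r x ≤ wnorm w a b r y) :
    ∃ t : Fin (n + 1) → ℝ, StrictMono t ∧ a ≤ t 0 ∧ t (Fin.last n) ≤ b ∧
      (∀ k, w (t k) * gap r x (t k) = wnorm w a b r x) := by
  set lo : Fin (n + 1) → ℝ := Fin.cons a x with hlo
  set hi : Fin (n + 1) → ℝ := Fin.snoc x b with hhi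
  have hlo_mem : ∀ k, lo k ∈ Icc a b := by
    refine Fin.cases ?_ fun k => ?_
    · simpa [hlo] using hab.le
    · simpa [hlo] using hx.2 k
  have hhi_mem : ∀ k, hi k ∈ Icc a b := by
    refine Fin.lastCases ?_ fun k => ?_
    · simpa [hhi] using hab.le
    · simpa [hhi] using hx.2 k
  have hlohi : ∀ k, lo k ≤ hi k := by
    refine Fin.cases ?_ fun k => ?_
    · simpa [hlo] using (hhi_mem 0).1
    · have h1 : lo k.succ = x k := by simp [hlo]
      rw [h1]
      by_cases hk : k.succ = Fin.last n
      · rw [hk]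
        simpa [hhi] using (hx.2 k).2
      · obtain ⟨l, hl⟩ := Fin.exists_castSucc_eq.2 hk
        rw [← hl]
        simp only [hhi, Fin.snoc_castSucc]
        refine hx.1 (Fin.le_def.2 ?_)
        have := congrArg Fin.val hl
        simp at this
        omega
  have hex : ∀ k, ∃ t ∈ Icc (lo k) (hi k), w t * gap r x t = wnorm w a b r x := by
    intro k
    by_contra! hno
    have hL : lo k = a ∨ ∃ i : Fin n, i.val < k.val ∧ x i = lo k := by
      refine Fin.cases (Or.inl (by simp [hlo])) (fun i => Or.inr ⟨i, by simp, by simp [hlo]⟩) k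
    have hR : hi k = b ∨ ∃ i : Fin n, k.val ≤ i.val ∧ x i = hi k := by
      refine Fin.lastCases (Or.inl (by simp [hhi])) (fun i => Or.inr ⟨i, by simp, by simp [hhi]⟩) k
    obtain ⟨y, hy, hlt⟩ :=
      exists_wnorm_lt_of_empty_gap hr hab hw0 husc hx hpos k.val (hlohi k) hL hR hno
    exact absurd (hmin y hy) (not_le.2 hlt)
  choose t htm hteq using hex
  refine ⟨t, ?_, ?_, ?_, hteq⟩
  · refine Fin.strictMono_iff_lt_succ.2 fun k => ?_
    have hne : ∀ l i, t l ≠ x i := fun l => by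
      have htl : t l ∈ Icc a b :=
        ⟨(hlo_mem l).1.trans (htm l).1, (htm l).2.trans (hhi_mem l).2⟩
      exact ne_node_of_gap_pos hr (pos_of_mul_pos_right (hteq l ▸ hpos) (hw0 _ htl))
    have h1 : t k.castSucc ≤ x k := by simpa [hhi] using (htm k.castSucc).2
    have h2 : x k ≤ t k.succ := by simpa [hlo] using (htm k.succ).1
    exact (lt_of_le_of_ne h1 (hne _ _)).trans_le h2
  · exact (hlo_mem 0).1.trans (htm 0).1
  · exact (htm _).2.trans (hhi_mem _).2

theorem statement17 (n : ℕ) (hn : 0 < n) (r : Fin n → ℝ) (hr : ∀ j, 0 < r j)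
    (a b : ℝ) (hab : a < b)
    (w : ℝ → ℝ) (hw0 : ∀ t ∈ Icc a b, 0 ≤ w t)
    (husc : UpperSemicontinuousOn w (Icc a b)) (hcard : weightCardGT w a b n)
    (hlogconc : ∀ t₁ ∈ Icc a b, ∀ t₂ ∈ Icc a b, ∀ l ∈ Icc (0:ℝ) 1,
      w t₁ ^ l * w t₂ ^ (1 - l) ≤ w (l * t₁ + (1 - l) * t₂)) :
    ∀ x : Fin n → ℝ, adm a b x →
      (((∀ x' : Fin n → ℝ, adm a b x' → wnorm w a b r x ≤ wnorm w a b r x') ∧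
        (∀ x' : Fin n → ℝ, adm a b x' →
          (∀ x'' : Fin n → ℝ, adm a b x'' → wnorm w a b r x' ≤ wnorm w a b r x'') →
          x' = x)) ↔
        ∃ t : Fin (n + 1) → ℝ, StrictMono t ∧ a ≤ t 0 ∧ t (Fin.last n) ≤ b ∧
          (∀ k, w (t k) * gap r x (t k) = wnorm w a b r x)) := by
  intro x hx
  have hpos := wnorm_pos hr hw0 husc hcard
  constructor
  · rintro ⟨hmin, -⟩
    exact exists_max_points_of_minimizer hr hab hw0 husc hx (hpos x) hmin
  · rintro ⟨t, ht, hta, htb, heq⟩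
    have hxt := equioscillates_of_eq hn hr hw0 husc hlogconc hx.1 (hpos x) ht hta htb heq
    have huniq : ∀ y : Fin n → ℝ, adm a b y →
        (∀ z : Fin n → ℝ, adm a b z → wnorm w a b r y ≤ wnorm w a b r z) → y = x := by
      intro y hy hmin
      obtain ⟨s, hs, hsa, hsb, hseq⟩ :=
        exists_max_points_of_minimizer hr hab hw0 husc hy (hpos y) hmin
      have hys := equioscillates_of_eq hn hr hw0 husc hlogconc hy.1 (hpos y) hs hsa hsb hseq
      exact funext fun j => le_antisymm
        (hxt.le hn hr hw0 husc hlogconc (hpos x) (hpos y) hys j)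
        (hys.le hn hr hw0 husc hlogconc (hpos y) (hpos x) hxt j)
    refine ⟨?_, huniq⟩
    obtain ⟨y, hy, hmin⟩ := exists_wnorm_minimizer hr hab husc
    rwa [← huniq y hy hmin]
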